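/- Fix an integer m ≥ 1 and a real number q > 1, and set t := q^{−1/2}. For every B-regular (m+1)-tuple a and every C-regular m-tuple b of nonzero complex numbers, A_B(t; a, b) = (1 + t^{2m+1}) · ∏_{k=1}^{m} (1 + t^{2k−1})(1 − t^{2k}). Equivalently, writing q_F := t^{−1}, A_B(t;a,b) = ( L(1,χ)·ζ(2)·L(3,χ)·ζ(4) ⋯ ζ(2m)·L(2m+1,χ) )^{−1}, where ζ(s) = (1 − q_F^{−s})^{−1} and L(s,χ) = (1 + q_F^{−s})^{−1}. -/

import Mathlib

noncomputable section

namespace GrossPrasadCaseB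

/-- The group `W_n = (ℤ/2)^n ⋊ S_n` of signed permutations, encoded as a pair of a sign
vector and a permutation. -/
abbrev SignedPerm (n : ℕ) := (Fin n → Bool) × Equiv.Perm (Fin n)

/-- The action of a signed permutation on an `n`-tuple: permute and invert marked
coordinates, `((ε,σ)·a)_k = a_{σ⁻¹ k}^{ε_k}`. -/
def sact {n : ℕ} (w : SignedPerm n) (a : Fin n → ℂ) : Fin n → ℂ :=
  fun k => if w.1 k then (a (w.2⁻¹ k))⁻¹ else a (w.2⁻¹ k)

/-- The numerator product `b(Ξ,ξ)` of Case B, for an `(m+1)`-tuple `a` and an `m`-tuple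
`b`:  `∏_{i=1}^{m+1}(1-ta_i) ∏_{1≤i≤j≤m}(1-ta_ib_j)(1-ta_ib_j⁻¹)
∏_{1≤j<i≤m+1}(1-ta_ib_j)(1-ta_i⁻¹b_j)`. -/
def bB (m : ℕ) (t : ℂ) (a : Fin (m + 1) → ℂ) (b : Fin m → ℂ) : ℂ :=
  (∏ i : Fin (m + 1), (1 - t * a i)) *
    (∏ p ∈ Finset.univ.filter fun p : Fin m × Fin m => p.1 ≤ p.2,
      ((1 - t * a p.1.castSucc * b p.2) * (1 - t * a p.1.castSucc * (b p.2)⁻¹))) *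
    ∏ p ∈ Finset.univ.filter fun p : Fin (m + 1) × Fin m => (p.2 : ℕ) < (p.1 : ℕ),
      ((1 - t * a p.1 * b p.2) * (1 - t * (a p.1)⁻¹ * b p.2))

/-- The factor `d_1(Ξ)` of Case B. -/
def d1B (m : ℕ) (a : Fin (m + 1) → ℂ) : ℂ :=
  (∏ i : Fin (m + 1), (1 - a i)) *
    ∏ p ∈ Finset.univ.filter fun p : Fin (m + 1) × Fin (m + 1) => p.1 < p.2,
      ((1 - a p.1 * a p.2) * (1 - a p.1 * (a p.2)⁻¹))

/-- The factor `d_0(ξ)` of Case B. -/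
def d0B (m : ℕ) (b : Fin m → ℂ) : ℂ :=
  (∏ i : Fin m, (1 - b i ^ 2)) *
    ∏ p ∈ Finset.univ.filter fun p : Fin m × Fin m => p.1 < p.2,
      ((1 - b p.1 * b p.2) * (1 - b p.1 * (b p.2)⁻¹))

/-- `c(Ξ,ξ) = b(Ξ,ξ) / (d_1(Ξ) d_0(ξ))` of Case B. -/
def cB (m : ℕ) (t : ℂ) (a : Fin (m + 1) → ℂ) (b : Fin m → ℂ) : ℂ :=
  bB m t a b / (d1B m a * d0B m b)

/-- The Weyl-group sum `A_{Ξ,ξ} = ∑_{w' ∈ W_{m+1}, w ∈ W_m} c(w'Ξ, wξ)` of Case B. -/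
def AB (m : ℕ) (t : ℂ) (a : Fin (m + 1) → ℂ) (b : Fin m → ℂ) : ℂ :=
  ∑ w' : SignedPerm (m + 1), ∑ w : SignedPerm m, cB m t (sact w' a) (sact w b)

/-- B-regularity: `a_i ≠ 1`, `a_i a_j ≠ 1` for `i < j`, and the `a_i` are pairwise
distinct. -/
def BRegular (n : ℕ) (a : Fin n → ℂ) : Prop :=
  (∀ i, a i ≠ 1) ∧ (∀ i j : Fin n, i < j → a i * a j ≠ 1) ∧
    ∀ i j : Fin n, i ≠ j → a i ≠ a j

/-- C-regularity: `b_i b_j ≠ 1` for `i ≤ j` and the `b_i` are pairwise distinct. -/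
def CRegular (n : ℕ) (b : Fin n → ℂ) : Prop :=
  (∀ i j : Fin n, i ≤ j → b i * b j ≠ 1) ∧ ∀ i j : Fin n, i ≠ j → b i ≠ b j

open Polynomial in
lemma eval_chebyshevS_mul (x : ℂ) (hx : x ≠ 0) (n : ℤ) :
    (Chebyshev.S ℂ n).eval (x + x⁻¹) * (x⁻¹ - x) = x ^ (-(n + 1)) - x ^ (n + 1) := by
  induction n using Chebyshev.induct with
  | zero => simp
  | one =>
    simp only [Chebyshev.S_one, eval_X]
    norm_num [zpow_neg]
    field_simp
    norm_cast
    field_simp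
    ring
  | add_two n h1 h2 =>
    rw [Chebyshev.S_add_two, eval_sub, eval_mul, eval_X, sub_mul, mul_assoc, h1, h2]
    simp only [neg_add, zpow_add₀ hx, zpow_neg, zpow_ofNat]
    field_simp
    ring
  | neg_add_one n h1 h2 =>
    rw [Chebyshev.S_sub_one, eval_sub, eval_mul, eval_X, sub_mul, mul_assoc, h1, h2]
    simp only [neg_add, zpow_add₀ hx, zpow_neg, zpow_ofNat, neg_neg, sub_eq_add_neg]
    field_simp
    ring

open Polynomial in
lemma natDegree_chebyshevS_le (n : ℕ) :
    (Chebyshev.S ℂ n).natDegree ≤ n ∧ (Chebyshev.S ℂ n).coeff n = 1 := by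
  induction n using Nat.twoStepInduction with
  | zero => simp
  | one => simp
  | more n h1 h2 =>
    push_cast at h2 ⊢
    rw [Chebyshev.S_add_two]
    refine ⟨(natDegree_sub_le _ _).trans (max_le ?_ (h1.1.trans (by omega))), ?_⟩
    · refine natDegree_mul_le.trans ?_
      rw [natDegree_X]
      omega
    · rw [coeff_sub, coeff_X_mul, h2.2, coeff_eq_zero_of_natDegree_lt (n := n + 2) (by omega)]
      simp

open Polynomial in
/-- Degree and top coefficient of `S (m - j)` for `0 ≤ j ≤ 2 m + 2`. -/
lemma natDegree_chebyshevS_sub_le (m j : ℕ) (hj : j < 2 * m + 3) :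
    (Chebyshev.S ℂ ((m : ℤ) - j)).natDegree ≤ m ∧
      (Chebyshev.S ℂ ((m : ℤ) - j)).coeff m =
        (if j = 0 then 1 else 0) - (if j = 2 * m + 2 then 1 else 0) := by
  rcases lt_trichotomy j (m + 1) with h | h | h
  · obtain ⟨k, rfl⟩ := Nat.exists_eq_add_of_le (Nat.lt_succ_iff.mp h)
    have := natDegree_chebyshevS_le k
    have e : ((j + k : ℕ) : ℤ) - j = k := by push_cast; ring
    rw [e, if_neg (by omega : ¬ j = 2 * (j + k) + 2)]
    refine ⟨this.1.trans (by omega), ?_⟩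
    split_ifs with h0
    · subst h0; simpa using this.2
    · rw [coeff_eq_zero_of_natDegree_lt (by omega)]; simp
  · subst h
    simp [Chebyshev.S_neg_one]
    omega
  · obtain ⟨k, rfl⟩ := Nat.exists_eq_add_of_lt h
    have := natDegree_chebyshevS_le k
    have e : ((m : ℤ)) - ((m + 1 + k + 1 : ℕ) : ℤ) = -k - 2 := by push_cast; ring
    rw [e, Chebyshev.S_neg_sub_two, if_neg (by omega), natDegree_neg, coeff_neg]
    refine ⟨this.1.trans (by omega), ?_⟩
    split_ifs with h0
    · have : k = m := by omega
      subst this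
      simp [this.2]
    · rw [coeff_eq_zero_of_natDegree_lt (by omega)]; simp

open Polynomial in
/-- Antisymmetrising a polynomial of degree at most `2 m + 2` and dividing by `x⁻¹ - x` gives a
polynomial of degree at most `m` in `x + x⁻¹`. -/
lemma exists_antisymm_quotient (m : ℕ) (K : ℂ[X]) (hK : K.natDegree ≤ 2 * m + 2) :
    ∃ p : ℂ[X], p.natDegree ≤ m ∧ p.coeff m = K.coeff 0 - K.coeff (2 * m + 2) ∧
      ∀ x : ℂ, x ≠ 0 → x ^ 2 ≠ 1 →
        K.eval x / ((1 - x ^ 2) * x ^ m) + K.eval x⁻¹ / ((1 - x⁻¹ ^ 2) * x⁻¹ ^ m) =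
          p.eval (x + x⁻¹) := by
  refine ⟨∑ j ∈ Finset.range (2 * m + 3), C (K.coeff j) * Chebyshev.S ℂ ((m : ℤ) - j),
    ?_, ?_, ?_⟩
  · refine natDegree_sum_le_of_forall_le _ _ fun j hj => (natDegree_C_mul_le _ _).trans ?_
    exact (natDegree_chebyshevS_sub_le m j (by simpa using hj)).1
  · rw [finsetSum_coeff]
    have : ∀ j ∈ Finset.range (2 * m + 3), (C (K.coeff j) * Chebyshev.S ℂ ((m : ℤ) - j)).coeff m =
        (if j = 0 then K.coeff j else 0) - (if j = 2 * m + 2 then K.coeff j else 0) := by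
      intro j hj
      rw [coeff_C_mul, (natDegree_chebyshevS_sub_le m j (by simpa using hj)).2]
      split_ifs <;> simp
    rw [Finset.sum_congr rfl this, Finset.sum_sub_distrib]
    simp
  · intro x hx hx2
    have h1 : (1 : ℂ) - x ^ 2 ≠ 0 := sub_ne_zero.mpr (Ne.symm hx2)
    have h2 : x⁻¹ - x ≠ 0 := by
      intro h; apply h1; field_simp at h; linear_combination h
    have h3 : (1 : ℂ) - x⁻¹ ^ 2 ≠ 0 := by
      intro h; apply h1; field_simp at h; linear_combination -h
    rw [eval_finsetSum, eval_eq_sum_range' (n := 2 * m + 3) (by omega),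
      eval_eq_sum_range' (n := 2 * m + 3) (by omega), Finset.sum_div, Finset.sum_div,
      ← Finset.sum_add_distrib]
    refine Finset.sum_congr rfl fun j _ => ?_
    rw [← mul_left_inj' h2, eval_mul, eval_C, mul_assoc (K.coeff j), eval_chebyshevS_mul x hx]
    have e1 : x ^ (-((m : ℤ) - j + 1)) = x ^ j * (x⁻¹) ^ m * x⁻¹ := by
      rw [← zpow_natCast, ← zpow_natCast, inv_zpow', ← zpow_neg_one, ← zpow_add₀ hx,
        ← zpow_add₀ hx]; congr 1; ring
    have e2 : x ^ (((m : ℤ) - j + 1)) = x⁻¹ ^ j * x ^ m * x := by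
      rw [← zpow_natCast, ← zpow_natCast, inv_zpow', zpow_add_one₀ hx,
        ← zpow_add₀ hx]; congr 2; ring
    rw [e1, e2]
    have e3 : x⁻¹ - x = x⁻¹ * (1 - x ^ 2) := by field_simp
    have e4 : x⁻¹ - x = - (x * (1 - x⁻¹ ^ 2)) := by field_simp; ring
    rw [add_mul]
    nth_rw 1 [e3]
    rw [e4]
    simp only [inv_pow] at h3 ⊢
    field_simp
    ring

open Polynomial in
/-- Variant of `exists_antisymm_quotient` with denominator `1 - x`, valid also at `x = -1`. -/
lemma exists_symm_quotient (m : ℕ) (K : ℂ[X]) (hK : K.natDegree ≤ 2 * m + 1) :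
    ∃ p : ℂ[X], p.natDegree ≤ m ∧
      ∀ x : ℂ, x ≠ 0 → x ≠ 1 →
        K.eval x / ((1 - x) * x ^ m) + K.eval x⁻¹ / ((1 - x⁻¹) * x⁻¹ ^ m) =
          p.eval (x + x⁻¹) := by
  refine ⟨∑ j ∈ Finset.range (2 * m + 2), C (K.coeff j) *
    (Chebyshev.S ℂ ((m : ℤ) - j) + Chebyshev.S ℂ ((m : ℤ) - (j + 1 : ℕ))), ?_, ?_⟩
  · refine natDegree_sum_le_of_forall_le _ _ fun j hj => (natDegree_C_mul_le _ _).trans ?_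
    have hj := Finset.mem_range.mp hj
    exact (natDegree_add_le _ _).trans (max_le (natDegree_chebyshevS_sub_le m j (by omega)).1
      (natDegree_chebyshevS_sub_le m (j + 1) (by omega)).1)
  · intro x hx hx1
    have h1 : (1 : ℂ) - x ≠ 0 := sub_ne_zero.mpr (Ne.symm hx1)
    have h3 : (1 : ℂ) - x⁻¹ ≠ 0 := by
      intro h; apply h1; field_simp at h; linear_combination -h
    have key : ∀ n : ℤ, ((Chebyshev.S ℂ n).eval (x + x⁻¹) +
        (Chebyshev.S ℂ (n - 1)).eval (x + x⁻¹)) * (1 - x) = x ^ (-n) - x ^ (n + 1) := by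
      intro n
      induction n using Chebyshev.induct with
      | zero => simp [Chebyshev.S_neg_one]
      | one =>
        norm_num [Chebyshev.S_one, zpow_neg]
        field_simp
        norm_cast
        ring
      | add_two n h1 h2 =>
        have e : (n : ℤ) + 2 - 1 = n + 1 := by ring
        have e' : Chebyshev.S ℂ ((n : ℤ) + 1) = X * Chebyshev.S ℂ n - Chebyshev.S ℂ (n - 1) :=
          Chebyshev.S_add_one ℂ n
        have e2 : (n : ℤ) + 1 - 1 = n := by ring
        rw [e2] at h1
        rw [e, Chebyshev.S_add_two]
        have e3 := congrArg (eval (x + x⁻¹)) e'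
        rw [eval_sub, eval_mul, eval_X] at e3 ⊢
        have : x ^ (-((n : ℤ) + 2)) - x ^ ((n : ℤ) + 2 + 1) = (x + x⁻¹) *
          (x ^ (-((n : ℤ) + 1)) - x ^ ((n : ℤ) + 1 + 1)) - (x ^ (-(n : ℤ)) - x ^ ((n : ℤ) + 1)) := by
          simp only [neg_add, zpow_add₀ hx, zpow_neg, zpow_ofNat]
          field_simp
          ring
        rw [this, ← h1, ← h2]
        linear_combination (1 - x) * e3
      | neg_add_one n h1 h2 =>
        have e := congrArg (eval (x + x⁻¹)) (Chebyshev.S_sub_one ℂ (-(n : ℤ)))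
        have e' := congrArg (eval (x + x⁻¹)) (Chebyshev.S_sub_one ℂ (-(n : ℤ) - 1))
        have e2 : -(n : ℤ) + 1 - 1 = -n := by ring
        have e2' : -(n : ℤ) - 1 + 1 = -n := by ring
        rw [e2] at h2
        rw [e2'] at e'
        rw [eval_sub, eval_mul, eval_X] at e e'
        have : x ^ (-(-(n : ℤ) - 1)) - x ^ (-(n : ℤ) - 1 + 1) = (x + x⁻¹) *
          (x ^ (-(-(n : ℤ))) - x ^ (-(n : ℤ) + 1)) - (x ^ (-(-(n : ℤ) + 1)) - x ^ (-(n : ℤ) + 1 + 1)) := by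
          simp only [neg_add, zpow_add₀ hx, zpow_neg, zpow_ofNat, neg_neg, sub_eq_add_neg]
          field_simp
          ring
        rw [this, ← h1, ← h2]
        linear_combination (1 - x) * e + (1 - x) * e'
    rw [eval_finsetSum, eval_eq_sum_range' (n := 2 * m + 2) (by omega),
      eval_eq_sum_range' (n := 2 * m + 2) (by omega), Finset.sum_div, Finset.sum_div,
      ← Finset.sum_add_distrib]
    refine Finset.sum_congr rfl fun j _ => ?_
    have e0 : (m : ℤ) - (j + 1 : ℕ) = (m : ℤ) - j - 1 := by push_cast; ring
    rw [← mul_left_inj' h1, eval_mul, eval_C, mul_assoc (K.coeff j), eval_add, e0, key]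
    have e1 : x ^ (-((m : ℤ) - j)) = x ^ j * (x⁻¹) ^ m := by
      rw [← zpow_natCast, ← zpow_natCast, inv_zpow', ← zpow_add₀ hx]; congr 1; ring
    have e2 : x ^ (((m : ℤ) - j + 1)) = x⁻¹ ^ j * x ^ m * x := by
      rw [← zpow_natCast, ← zpow_natCast, inv_zpow', zpow_add_one₀ hx,
        ← zpow_add₀ hx]; congr 2; ring
    have e4 : 1 - x = - (x * (1 - x⁻¹)) := by field_simp; ring
    rw [e1, e2, add_mul]
    nth_rw 3 [e4]
    simp only [inv_pow] at h3 ⊢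
    field_simp
    ring

/-- The Vandermonde product in the variables `a i + (a i)⁻¹`. -/
def symVandermonde {n : ℕ} (a : Fin n → ℂ) : ℂ :=
  (Matrix.vandermonde fun i => a i + (a i)⁻¹).det

lemma symVandermonde_eq_prod {n : ℕ} (a : Fin n → ℂ) :
    symVandermonde a =
      ∏ i, ∏ j ∈ Finset.Ioi i, ((a j + (a j)⁻¹) - (a i + (a i)⁻¹)) :=
  Matrix.det_vandermonde _

lemma sact_add_inv {n : ℕ} (w : SignedPerm n) (a : Fin n → ℂ) (k : Fin n) :
    sact w a k + (sact w a k)⁻¹ = a (w.2⁻¹ k) + (a (w.2⁻¹ k))⁻¹ := by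
  unfold sact
  split_ifs
  · rw [inv_inv, add_comm]
  · rfl

lemma symVandermonde_sact {n : ℕ} (w : SignedPerm n) (a : Fin n → ℂ) :
    symVandermonde (sact w a) = (Equiv.Perm.sign w.2 : ℤ) * symVandermonde a := by
  unfold symVandermonde
  simp_rw [sact_add_inv]
  rw [← Equiv.Perm.sign_inv, ← Matrix.det_permute]
  rfl

/-- A product-form sum over the hyperoctahedral group, divided by an alternating Vandermonde
product, is a determinant. -/
lemma sum_signedPerm_prod_div {n : ℕ} (φ : Fin n → ℂ → ℂ) (a : Fin n → ℂ) :
    ∑ w : SignedPerm n, (∏ i, φ i (sact w a i)) / symVandermonde (sact w a) =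
      (Matrix.of fun i j => φ i (a j) + φ i (a j)⁻¹).det / symVandermonde a := by
  rw [Matrix.det_apply, Fintype.sum_prod_type, Finset.sum_comm, Finset.sum_div]
  refine Finset.sum_congr rfl fun σ _ => ?_
  simp only [symVandermonde_sact, Matrix.of_apply]
  rw [← Finset.sum_div]
  have h : ∑ ε : Fin n → Bool, ∏ i, φ i (sact (ε, σ) a i) =
      ∏ i, (φ (σ i) (a i) + φ (σ i) (a i)⁻¹) := by
    have hσ : ∏ i, (φ (σ i) (a i) + φ (σ i) (a i)⁻¹) =
        ∏ i, (φ i (a (σ⁻¹ i)) + φ i (a (σ⁻¹ i))⁻¹) := by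
      rw [← Equiv.prod_comp σ fun i => φ i (a (σ⁻¹ i)) + φ i (a (σ⁻¹ i))⁻¹]
      simp
    rw [hσ]
    have := Finset.prod_univ_sum (fun _ : Fin n => (Finset.univ : Finset Bool))
      (fun i e => φ i (if e then (a (σ⁻¹ i))⁻¹ else a (σ⁻¹ i)))
    simp only [Fintype.sum_bool, if_true, Bool.false_eq_true, if_false, Fintype.piFinset_univ]
      at this
    simp_rw [add_comm (φ _ (a _))]
    rw [this]
    rfl
  rw [h]
  rcases Int.units_eq_one_or (Equiv.Perm.sign σ) with hs | hs <;> simp [hs, neg_div, div_neg]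

/-- If the symmetrised functions are polynomials of degree `< n` in `x + x⁻¹`, the determinant
ratio does not depend on the point. -/
lemma det_div_symVandermonde_eq {n : ℕ} (φ : Fin n → ℂ → ℂ) (p : Fin n → Polynomial ℂ)
    (hp : ∀ i, (p i).natDegree < n) (a a' : Fin n → ℂ)
    (h : ∀ i j, φ i (a j) + φ i (a j)⁻¹ = (p i).eval (a j + (a j)⁻¹))
    (h' : ∀ i j, φ i (a' j) + φ i (a' j)⁻¹ = (p i).eval (a' j + (a' j)⁻¹))
    (hv : symVandermonde a ≠ 0) (hv' : symVandermonde a' ≠ 0) :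
    (Matrix.of fun i j => φ i (a j) + φ i (a j)⁻¹).det / symVandermonde a =
      (Matrix.of fun i j => φ i (a' j) + φ i (a' j)⁻¹).det / symVandermonde a' := by
  have key : ∀ c : Fin n → ℂ,
      (∀ i j, φ i (c j) + φ i (c j)⁻¹ = (p i).eval (c j + (c j)⁻¹)) → symVandermonde c ≠ 0 →
      (Matrix.of fun i j => φ i (c j) + φ i (c j)⁻¹).det / symVandermonde c =
        (Matrix.of fun i k : Fin n => (p i).coeff k).det := by
    intro c hc hcv
    rw [div_eq_iff hcv, symVandermonde, ← Matrix.det_transpose (Matrix.vandermonde _),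
      ← Matrix.det_mul]
    congr 1
    ext i j
    rw [Matrix.of_apply, hc, Polynomial.eval_eq_sum_range' (hp i), Matrix.mul_apply,
      Finset.sum_range]
    rfl
  rw [key a h hv, key a' h' hv']

/-- The part of the numerator `bB` that involves the `i`-th coordinate of `a`. -/
def rowNum (m : ℕ) (t : ℂ) (b : Fin m → ℂ) (i : Fin (m + 1)) (x : ℂ) : ℂ :=
  (1 - t * x) * ∏ j : Fin m, ((1 - t * x * b j) *
    if (j : ℕ) < i then 1 - t * x⁻¹ * b j else 1 - t * x * (b j)⁻¹)

lemma bB_eq_prod (m : ℕ) (t : ℂ) (a : Fin (m + 1) → ℂ) (b : Fin m → ℂ) :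
    bB m t a b = ∏ i, rowNum m t b i (a i) := by
  unfold bB rowNum
  rw [Finset.prod_mul_distrib (f := fun i => 1 - t * a i), mul_assoc, Finset.prod_filter,
    Finset.prod_filter, Fintype.prod_prod_type, Fintype.prod_prod_type]
  dsimp only
  congr 1
  have h : ∏ x : Fin m, ∏ y : Fin m, (if x ≤ y then
        (1 - t * a x.castSucc * b y) * (1 - t * a x.castSucc * (b y)⁻¹) else 1) =
      ∏ x : Fin (m + 1), ∏ y : Fin m, (if (y : ℕ) < x then 1 else
        (1 - t * a x * b y) * (1 - t * a x * (b y)⁻¹)) := by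
    rw [Fin.prod_univ_castSucc]
    simp only [Fin.val_castSucc, Fin.val_last, Fin.is_lt, if_true, Finset.prod_const_one, mul_one]
    refine Finset.prod_congr rfl fun x _ => Finset.prod_congr rfl fun y _ => ?_
    by_cases hxy : x ≤ y
    · rw [if_pos hxy, if_neg (by simpa using hxy)]
    · rw [if_neg hxy, if_pos (by simpa using hxy)]
  rw [h, ← Finset.prod_mul_distrib]
  refine Finset.prod_congr rfl fun x _ => ?_
  rw [← Finset.prod_mul_distrib]
  refine Finset.prod_congr rfl fun y _ => ?_
  split_ifs <;> ring

lemma prod_filter_lt_eq {n : ℕ} (f : Fin n → Fin n → ℂ) :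
    ∏ p ∈ Finset.univ.filter (fun p : Fin n × Fin n => p.1 < p.2), f p.1 p.2 =
      ∏ i, ∏ j ∈ Finset.Ioi i, f i j := by
  rw [Finset.prod_filter, Fintype.prod_prod_type]
  refine Finset.prod_congr rfl fun i _ => ?_
  rw [← Finset.prod_filter]
  refine Finset.prod_congr ?_ fun _ _ => rfl
  ext j
  simp

/-- The `i`-th row function in the product formula for `cB`. -/
def rowFun (m : ℕ) (t : ℂ) (b : Fin m → ℂ) (i : Fin (m + 1)) (x : ℂ) : ℂ :=
  rowNum m t b i x / ((1 - x) * (-x) ^ (m - (i : ℕ)))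

lemma d1B_eq (m : ℕ) (a : Fin (m + 1) → ℂ) (ha0 : ∀ i, a i ≠ 0) :
    d1B m a = (∏ i, ((1 - a i) * (-a i) ^ (m - (i : ℕ)))) * symVandermonde a := by
  unfold d1B
  rw [prod_filter_lt_eq fun i j => (1 - a i * a j) * (1 - a i * (a j)⁻¹), symVandermonde_eq_prod,
    Finset.prod_mul_distrib (f := fun i => 1 - a i), mul_assoc]
  congr 1
  rw [← Finset.prod_mul_distrib]
  refine Finset.prod_congr rfl fun i _ => ?_
  have hc : (-a i) ^ (m - (i : ℕ)) = ∏ _j ∈ Finset.Ioi i, (-a i) := by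
    rw [Finset.prod_const, Fin.card_Ioi]
    congr 1
  rw [hc, ← Finset.prod_mul_distrib]
  refine Finset.prod_congr rfl fun j _ => ?_
  have := ha0 i
  have := ha0 j
  field_simp
  ring

lemma cB_eq (m : ℕ) (t : ℂ) (a : Fin (m + 1) → ℂ) (b : Fin m → ℂ) (ha0 : ∀ i, a i ≠ 0) :
    cB m t a b = (∏ i, rowFun m t b i (a i)) / symVandermonde a / d0B m b := by
  unfold cB rowFun
  rw [bB_eq_prod, d1B_eq m a ha0, Finset.prod_div_distrib, div_div, div_div, mul_assoc]

lemma sact_ne_zero {n : ℕ} (w : SignedPerm n) (a : Fin n → ℂ) (ha0 : ∀ i, a i ≠ 0) (k : Fin n) :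
    sact w a k ≠ 0 := by
  unfold sact
  split_ifs
  · exact inv_ne_zero (ha0 _)
  · exact ha0 _

lemma sum_cB_eq_det (m : ℕ) (t : ℂ) (a : Fin (m + 1) → ℂ) (b : Fin m → ℂ) (ha0 : ∀ i, a i ≠ 0) :
    ∑ w : SignedPerm (m + 1), cB m t (sact w a) b =
      (Matrix.of fun i j => rowFun m t b i (a j) + rowFun m t b i (a j)⁻¹).det /
        symVandermonde a / d0B m b := by
  rw [← sum_signedPerm_prod_div, Finset.sum_div]
  exact Finset.sum_congr rfl fun w _ => cB_eq m t _ b (sact_ne_zero w a ha0)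

open Polynomial in
lemma exists_rowFun_symm_eq (m : ℕ) (t : ℂ) (b : Fin m → ℂ) (i : Fin (m + 1)) :
    ∃ p : ℂ[X], p.natDegree < m + 1 ∧ ∀ x : ℂ, x ≠ 0 → x ≠ 1 →
      rowFun m t b i x + rowFun m t b i x⁻¹ = p.eval (x + x⁻¹) := by
  set K : ℂ[X] := C ((-1) ^ (m - (i : ℕ))) * ((1 - C t * X) * ∏ j : Fin m,
    ((1 - C (t * b j) * X) *
      if (j : ℕ) < i then X - C (t * b j) else 1 - C (t * (b j)⁻¹) * X)) with hK
  have hlin : ∀ c : ℂ, (1 - C c * X : ℂ[X]).natDegree ≤ 1 := fun c =>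
    (natDegree_sub_le _ _).trans (max_le (by simp) (natDegree_C_mul_le _ _ |>.trans natDegree_X_le))
  have hdeg : K.natDegree ≤ 2 * m + 1 := by
    refine (natDegree_C_mul_le _ _).trans (natDegree_mul_le.trans ?_)
    have : (∏ j : Fin m, ((1 - C (t * b j) * X) *
        if (j : ℕ) < i then X - C (t * b j) else 1 - C (t * (b j)⁻¹) * X)).natDegree ≤ 2 * m := by
      refine (natDegree_prod_le _ _).trans ((Finset.sum_le_card_nsmul _ _ 2 fun j _ => ?_).trans ?_)
      · refine natDegree_mul_le.trans (Nat.add_le_add (hlin _) (?_ : _ ≤ 1))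
        split_ifs
        · exact (natDegree_X_sub_C _).le
        · exact hlin _
      · simp [mul_comm]
    have := hlin t
    omega
  have heval : ∀ x : ℂ, x ≠ 0 → rowFun m t b i x = K.eval x / ((1 - x) * x ^ m) := by
    intro x hx
    have hcard : ∏ j : Fin m, (if (j : ℕ) < i then x else 1) = x ^ (i : ℕ) := by
      rw [Finset.prod_ite, Finset.prod_const, Finset.prod_const_one, mul_one,
        Fin.card_filter_val_lt, min_eq_right (Nat.lt_succ_iff.mp i.2)]
    have hprod : ∏ j : Fin m, ((1 - t * b j * x) *
        (if (j : ℕ) < i then x - t * b j else 1 - t * (b j)⁻¹ * x)) = x ^ (i : ℕ) *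
        ∏ j : Fin m, ((1 - t * x * b j) *
          if (j : ℕ) < i then 1 - t * x⁻¹ * b j else 1 - t * x * (b j)⁻¹) := by
      rw [← hcard, ← Finset.prod_mul_distrib]
      refine Finset.prod_congr rfl fun j _ => ?_
      split_ifs
      · field_simp
      · ring
    have hKe : K.eval x = (-1) ^ (m - (i : ℕ)) * (x ^ (i : ℕ) * rowNum m t b i x) := by
      rw [hK, eval_mul, eval_C, eval_mul, eval_prod]
      simp only [eval_mul, eval_sub, eval_one, eval_C, eval_X, apply_ite (eval x)]
      rw [hprod, rowNum]
      ring
    have hpow : x ^ m = x ^ (m - (i : ℕ)) * x ^ (i : ℕ) := by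
      rw [← pow_add, Nat.sub_add_cancel (Nat.lt_succ_iff.mp i.2)]
    have hsq : ((-1 : ℂ) ^ (m - (i : ℕ))) * (-1) ^ (m - (i : ℕ)) = 1 := by
      rw [← mul_pow]; simp
    rw [hKe, rowFun, neg_pow x, hpow]
    rcases neg_one_pow_eq_or ℂ (m - (i : ℕ)) with h | h <;> rw [h] <;> field_simp
  obtain ⟨p, hp, hpe⟩ := exists_symm_quotient m K hdeg
  refine ⟨p, Nat.lt_succ_iff.mpr hp, fun x hx hx1 => ?_⟩
  rw [heval x hx, heval x⁻¹ (inv_ne_zero hx), hpe x hx hx1]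

lemma symVandermonde_ne_zero {n : ℕ} {a : Fin n → ℂ} (ha0 : ∀ i, a i ≠ 0)
    (hprod : ∀ i j, i < j → a i * a j ≠ 1) (hne : ∀ i j, i ≠ j → a i ≠ a j) :
    symVandermonde a ≠ 0 := by
  rw [symVandermonde_eq_prod]
  refine Finset.prod_ne_zero_iff.mpr fun i _ => Finset.prod_ne_zero_iff.mpr fun j hj => ?_
  have hij : i < j := Finset.mem_Ioi.mp hj
  have h : (a j + (a j)⁻¹) - (a i + (a i)⁻¹) =
      (a i - a j) * (1 - a i * a j) / (a i * a j) := by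
    have := ha0 i
    have := ha0 j
    field_simp
    ring
  rw [h]
  exact div_ne_zero (mul_ne_zero (sub_ne_zero.mpr (hne i j hij.ne))
    (sub_ne_zero.mpr (hprod i j hij).symm)) (mul_ne_zero (ha0 i) (ha0 j))

/-- The sum over the first group, evaluated by moving `a` to a point where only the identity
contributes. -/
lemma sum_cB_eq_snoc (m : ℕ) (t : ℂ) (a : Fin (m + 1) → ℂ) (b : Fin m → ℂ)
    (ha0 : ∀ i, a i ≠ 0) (ha : BRegular (m + 1) a) (hb0 : ∀ i, b i ≠ 0) (ht0 : t ≠ 0)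
    (hreg : BRegular (m + 1) (Fin.snoc (fun i => t * b i) t : Fin (m + 1) → ℂ)) :
    ∑ w : SignedPerm (m + 1), cB m t (sact w a) b =
      cB m t (Fin.snoc (fun i => t * b i) t : Fin (m + 1) → ℂ) b := by
  set a' : Fin (m + 1) → ℂ := Fin.snoc (fun i => t * b i) t with ha'
  have ha'0 : ∀ i, a' i ≠ 0 := by
    intro i
    refine Fin.lastCases ?_ (fun i => ?_) i
    · simpa [ha'] using ht0
    · simpa [ha'] using ⟨ht0, hb0 i⟩
  choose p hp hpe using exists_rowFun_symm_eq m t b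
  rw [sum_cB_eq_det m t a b ha0, cB_eq m t a' b ha'0,
    det_div_symVandermonde_eq (rowFun m t b) p hp a a'
      (fun i j => hpe i _ (ha0 j) (ha.1 j)) (fun i j => hpe i _ (ha'0 j) (hreg.1 j))
      (symVandermonde_ne_zero ha0 ha.2.1 ha.2.2) (symVandermonde_ne_zero ha'0 hreg.2.1 hreg.2.2)]
  have hinv : ∀ i j, rowFun m t b i (a' j)⁻¹ = 0 := by
    intro i j
    have : rowNum m t b i (a' j)⁻¹ = 0 := by
      unfold rowNum
      refine Fin.lastCases ?_ (fun j => ?_) j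
      · simp [ha', ht0]
      · rw [mul_eq_zero]
        refine Or.inr (Finset.prod_eq_zero (Finset.mem_univ j) ?_)
        have := hb0 j
        rw [ha', Fin.snoc_castSucc, mul_eq_zero]
        left
        field_simp
        simp
    rw [rowFun, this, zero_div]
  have hlower : ∀ i j, j < i → rowFun m t b i (a' j) = 0 := by
    intro i j hij
    have : rowNum m t b i (a' j) = 0 := by
      unfold rowNum
      revert hij
      refine Fin.lastCases ?_ (fun j => ?_) j
      · exact fun h => absurd (Fin.le_last i) (not_le.mpr h)
      · intro hij
        rw [mul_eq_zero]
        refine Or.inr (Finset.prod_eq_zero (Finset.mem_univ j) ?_)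
        have := hb0 j
        rw [if_pos (by simpa [Fin.lt_def] using hij), ha', Fin.snoc_castSucc, mul_eq_zero]
        right
        field_simp
        simp
    rw [rowFun, this, zero_div]
  simp only [hinv, add_zero]
  rw [Matrix.det_of_isUpperTriangular]
  · rfl
  · intro i j hij
    exact hlower i j hij

/-- The pair factor of the type `C` sum. -/
def pairC (t x y : ℂ) : ℂ :=
  (1 - t ^ 2 * x * y) * (1 - t ^ 2 * x * y⁻¹) / ((1 - x * y) * (1 - x * y⁻¹))

/-- The single-variable factor of the type `C` sum. -/
def singleC (t x : ℂ) : ℂ :=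
  (1 - t ^ 2) * (1 - t ^ 2 * x) * (1 + t * x) / (1 - x ^ 2)

/-- The summand of the type `C` sum. -/
def termC {n : ℕ} (t : ℂ) (b : Fin n → ℂ) : ℂ :=
  (∏ i, singleC t (b i)) * ∏ i, ∏ j ∈ Finset.Ioi i, pairC t (b i) (b j)

/-- Genericity of `b` relative to `t`. -/
structure GenericC {n : ℕ} (t : ℂ) (b : Fin n → ℂ) : Prop where
  ne_zero : ∀ i, b i ≠ 0
  mul_ne_one : ∀ i, t * b i ≠ 1
  mul_ne_neg_one : ∀ i, t * b i ≠ -1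
  ne_t : ∀ i, b i ≠ t
  ne_neg_t : ∀ i, b i ≠ -t
  pair : ∀ i j, b i * b j ≠ 1
  inj : Function.Injective b

lemma GenericC.comp {n k : ℕ} {t : ℂ} {b : Fin n → ℂ} (h : GenericC t b) {f : Fin k → Fin n}
    (hf : Function.Injective f) : GenericC t (b ∘ f) :=
  ⟨fun _ => h.ne_zero _, fun _ => h.mul_ne_one _, fun _ => h.mul_ne_neg_one _, fun _ => h.ne_t _,
    fun _ => h.ne_neg_t _, fun _ _ => h.pair _ _, h.inj.comp hf⟩

lemma pairC_inv (t x y : ℂ) : pairC t x y⁻¹ = pairC t x y := by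
  unfold pairC
  rw [inv_inv]
  ring

lemma pairC_eq (t : ℂ) {x y : ℂ} (hx : x ≠ 0) (hy : y ≠ 0) :
    pairC t x y = (1 + t ^ 4 * x ^ 2 - t ^ 2 * x * (y + y⁻¹)) /
      (x * ((x + x⁻¹) - (y + y⁻¹))) := by
  unfold pairC
  congr 1
  · field_simp
    ring
  · field_simp
    ring

lemma termC_cons {n : ℕ} (t x : ℂ) (b : Fin n → ℂ) :
    termC t (Fin.cons x b : Fin (n + 1) → ℂ) =
      singleC t x * (∏ j, pairC t x (b j)) * termC t b := by
  unfold termC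
  rw [Fin.prod_univ_succ, Fin.prod_univ_succ]
  simp only [Fin.prod_Ioi_zero, Fin.prod_Ioi_succ, Fin.cons_zero, Fin.cons_succ]
  ring

lemma prod_swap_succ {n : ℕ} (p : Fin (n + 1)) (f : Fin (n + 1) → ℂ) :
    ∏ j : Fin n, f (Equiv.swap 0 p j.succ) = ∏ k ∈ Finset.univ.erase p, f k := by
  refine Finset.prod_bij' (fun j _ => Equiv.swap 0 p j.succ)
    (fun k hk => (Equiv.swap 0 p k).pred ?_) ?_ ?_ ?_ ?_ ?_
  · intro h
    rw [Equiv.swap_apply_eq_iff, Equiv.swap_apply_left] at h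
    exact (Finset.mem_erase.mp hk).1 h
  · intro j _
    rw [Finset.mem_erase]
    refine ⟨fun h => ?_, Finset.mem_univ _⟩
    rw [Equiv.swap_apply_eq_iff, Equiv.swap_apply_right] at h
    exact Fin.succ_ne_zero _ h
  all_goals simp

lemma sum_termC_succ {n : ℕ} (t : ℂ) (b : Fin (n + 1) → ℂ) :
    ∑ w : SignedPerm (n + 1), termC t (sact w b) =
      ∑ p : Fin (n + 1), ∑ e : Bool,
        (singleC t (if e then (b p)⁻¹ else b p) *
          ∏ k ∈ Finset.univ.erase p, pairC t (if e then (b p)⁻¹ else b p) (b k)) *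
        ∑ w : SignedPerm n, termC t (sact w (b ∘ fun i => Equiv.swap 0 p i.succ)) := by
  let E : (Fin (n + 1) × Bool) × SignedPerm n ≃ SignedPerm (n + 1) :=
    { toFun := fun x => (Fin.cons x.1.2 x.2.1,
        (Equiv.Perm.decomposeFin.symm (x.1.1, x.2.2⁻¹))⁻¹)
      invFun := fun w => (((Equiv.Perm.decomposeFin w.2⁻¹).1, w.1 0),
        (Fin.tail w.1, (Equiv.Perm.decomposeFin w.2⁻¹).2⁻¹))
      left_inv := fun x => by simp
      right_inv := fun w => by simp }
  have hE : ∀ x, sact (E x) b =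
      Fin.cons (if x.1.2 then (b x.1.1)⁻¹ else b x.1.1)
        (sact x.2 (b ∘ fun i => Equiv.swap 0 x.1.1 i.succ)) := by
    intro x
    funext k
    refine Fin.cases ?_ (fun k => ?_) k
    · simp [sact, E]
    · simp [sact, E]
  rw [← E.sum_comp, Fintype.sum_prod_type, Fintype.sum_prod_type]
  refine Finset.sum_congr rfl fun p _ => Finset.sum_congr rfl fun e _ => ?_
  rw [Finset.mul_sum]
  refine Finset.sum_congr rfl fun w _ => ?_
  rw [hE, termC_cons]
  congr 2
  dsimp only
  generalize (if e then (b p)⁻¹ else b p) = x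
  rw [← prod_swap_succ p fun k => pairC t x (b k),
    ← Equiv.prod_comp w.2⁻¹ fun j => pairC t x (b (Equiv.swap 0 p j.succ))]
  refine Finset.prod_congr rfl fun j _ => ?_
  unfold sact
  split_ifs
  · rw [pairC_inv]; rfl
  · rfl

open Polynomial in
/-- The numerator polynomial of the one-variable symmetrisation in the type `C` sum. -/
def stepPoly {n : ℕ} (t : ℂ) (b : Fin n → ℂ) : ℂ[X] :=
  (1 - C (t ^ 2) * X) * (X - C t) *
    ∏ k, (1 + C (t ^ 4) * X ^ 2 - C (t ^ 2 * (b k + (b k)⁻¹)) * X)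

lemma eval_stepPoly {n : ℕ} (t : ℂ) (b : Fin n → ℂ) (x : ℂ) :
    (stepPoly t b).eval x = (1 - t ^ 2 * x) * (x - t) *
      ∏ k, (1 + t ^ 4 * x ^ 2 - t ^ 2 * x * (b k + (b k)⁻¹)) := by
  unfold stepPoly
  simp only [Polynomial.eval_mul, Polynomial.eval_prod, Polynomial.eval_sub, Polynomial.eval_add,
    Polynomial.eval_one, Polynomial.eval_C, Polynomial.eval_X, Polynomial.eval_pow]
  congr 1
  exact Finset.prod_congr rfl fun k _ => by ring

open Polynomial in
lemma natDegree_stepPoly {n : ℕ} (t : ℂ) (b : Fin n → ℂ) :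
    (stepPoly t b).natDegree ≤ 2 * n + 2 ∧
      (stepPoly t b).coeff (2 * n + 2) = -t ^ 2 * t ^ (4 * n) ∧
      (stepPoly t b).coeff 0 = -t := by
  have hf : ∀ k : Fin n, (1 + C (t ^ 4) * X ^ 2 - C (t ^ 2 * (b k + (b k)⁻¹)) * X : ℂ[X]).natDegree
      ≤ 2 := fun k => by compute_degree
  have hg : ((1 - C (t ^ 2) * X) * (X - C t) : ℂ[X]).natDegree ≤ 2 := by compute_degree
  have hP : (∏ k, (1 + C (t ^ 4) * X ^ 2 - C (t ^ 2 * (b k + (b k)⁻¹)) * X : ℂ[X])).natDegree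
      ≤ 2 * n := by
    refine (natDegree_prod_le _ _).trans ((Finset.sum_le_card_nsmul _ _ 2 fun k _ => hf k).trans ?_)
    simp [mul_comm]
  have hPc : (∏ k, (1 + C (t ^ 4) * X ^ 2 - C (t ^ 2 * (b k + (b k)⁻¹)) * X : ℂ[X])).coeff (2 * n)
      = t ^ (4 * n) := by
    have h := coeff_prod_of_natDegree_le Finset.univ _ 2 fun k _ => hf k
    rw [Finset.card_univ, Fintype.card_fin, mul_comm n 2] at h
    rw [h]
    have : ∀ k : Fin n,
        (1 + C (t ^ 4) * X ^ 2 - C (t ^ 2 * (b k + (b k)⁻¹)) * X : ℂ[X]).coeff 2 = t ^ 4 := by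
      intro k
      simp [coeff_one, -map_pow, -map_mul, coeff_C_mul]
    rw [Finset.prod_congr rfl fun k _ => this k, Finset.prod_const, Finset.card_univ,
      Fintype.card_fin, pow_mul]
  refine ⟨natDegree_mul_le.trans (by omega), ?_, ?_⟩
  · unfold stepPoly
    rw [add_comm (2 * n) 2, coeff_mul_add_eq_of_natDegree_le hg hP, hPc]
    congr 1
    have : ((1 - C (t ^ 2) * X) * (X - C t) : ℂ[X]) =
        C (-t ^ 2) * X ^ 2 + C (1 + t ^ 3) * X + C (-t) := by
      simp only [map_add, map_neg, map_pow, map_one]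
      ring
    rw [this]
    simp [-map_pow, -map_neg, -map_add, coeff_C_mul]
  · rw [coeff_zero_eq_eval_zero, eval_stepPoly]
    simp

lemma single_mul_prod_pairC_eq {n : ℕ} (t : ℂ) (b : Fin n → ℂ) (h : GenericC t b) (p : Fin n) (x : ℂ)
    (hx : x = b p ∨ x = (b p)⁻¹) :
    singleC t x * ∏ k ∈ Finset.univ.erase p, pairC t x (b k) =
      (stepPoly t b).eval x / ((1 - x ^ 2) * x ^ n) /
        ((1 + t ^ 2 - t * (b p + (b p)⁻¹)) *
          ∏ k ∈ Finset.univ.erase p, ((b p + (b p)⁻¹) - (b k + (b k)⁻¹))) := by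
  have hb := h.ne_zero p
  have hx0 : x ≠ 0 := by
    rcases hx with rfl | rfl
    · exact hb
    · exact inv_ne_zero hb
  have hz : x + x⁻¹ = b p + (b p)⁻¹ := by
    rcases hx with rfl | rfl
    · rfl
    · rw [inv_inv, add_comm]
  have h1 : 1 - t * x ≠ 0 := by
    rcases hx with rfl | rfl
    · exact sub_ne_zero.mpr (h.mul_ne_one p).symm
    · intro h0
      field_simp at h0
      exact h.ne_t p (by linear_combination h0)
  have h2 : x - t ≠ 0 := by
    rcases hx with rfl | rfl
    · exact sub_ne_zero.mpr (h.ne_t p)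
    · intro h0
      field_simp at h0
      exact h.mul_ne_one p (by linear_combination -h0)
  rw [eval_stepPoly, ← hz, ← Finset.mul_prod_erase _ _ (Finset.mem_univ p), ← hz]
  rw [Finset.prod_congr rfl fun k _ => pairC_eq t hx0 (h.ne_zero k), Finset.prod_div_distrib,
    Finset.prod_mul_distrib]
  have hpow : x ^ n = x * ∏ _k ∈ Finset.univ.erase p, x := by
    rw [Finset.mul_prod_erase _ (fun _ => x) (Finset.mem_univ p)]
    simp
  rw [hpow]
  have hD : (∏ k ∈ Finset.univ.erase p, ((x + x⁻¹) - (b k + (b k)⁻¹))) ≠ 0 := by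
    refine Finset.prod_ne_zero_iff.mpr fun k hk => ?_
    have hk := Finset.ne_of_mem_erase hk
    have e : (b p + (b p)⁻¹) - (b k + (b k)⁻¹) =
        (b k - b p) * (1 - b k * b p) / (b k * b p) := by
      have := h.ne_zero k
      field_simp
      ring
    rw [hz, e]
    exact div_ne_zero (mul_ne_zero (sub_ne_zero.mpr fun e => hk (h.inj e))
      (sub_ne_zero.mpr (h.pair k p).symm)) (mul_ne_zero (h.ne_zero k) hb)
  have hX : (∏ _k ∈ Finset.univ.erase p, x) ≠ 0 := Finset.prod_ne_zero_iff.mpr fun _ _ => hx0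
  have hx2 : 1 - x ^ 2 ≠ 0 := by
    intro h0
    rcases hx with rfl | rfl
    · exact h.pair p p (by linear_combination -h0)
    · field_simp at h0
      exact h.pair p p (by linear_combination h0)
  have e1 : 1 + t ^ 2 - t * (x + x⁻¹) = (1 - t * x) * (x - t) / x := by
    field_simp
    ring
  have e2 : 1 + t ^ 4 * x ^ 2 - t ^ 2 * x * (x + x⁻¹) =
      (1 - t * x) * (1 + t * x) * (1 - t ^ 2) := by
    field_simp
    ring
  rw [e1, e2]
  unfold singleC
  generalize (∏ _k ∈ Finset.univ.erase p, x) = A at *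
  generalize (∏ k ∈ Finset.univ.erase p, ((x + x⁻¹) - (b k + (b k)⁻¹))) = B at *
  generalize (∏ k ∈ Finset.univ.erase p, (1 + t ^ 4 * x ^ 2 - t ^ 2 * x * (b k + (b k)⁻¹))) = P
  field_simp

lemma prod_erase_option_none {n : ℕ} (f : Option (Fin n) → ℂ) :
    ∏ j ∈ Finset.univ.erase none, f j = ∏ k, f (some k) := by
  refine (Finset.prod_bij (fun k _ => some k) ?_ ?_ ?_ ?_).symm
  · simp
  · simp
  · intro j hj
    obtain ⟨k, rfl⟩ := Option.ne_none_iff_exists'.mp (Finset.ne_of_mem_erase hj)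
    exact ⟨k, Finset.mem_univ _, rfl⟩
  · simp

lemma prod_erase_option_some {n : ℕ} (f : Option (Fin n) → ℂ) (p : Fin n) :
    ∏ j ∈ Finset.univ.erase (some p), f j = f none * ∏ k ∈ Finset.univ.erase p, f (some k) := by
  have : (Finset.univ.erase (some p) : Finset (Option (Fin n))) =
      insert none ((Finset.univ.erase p).map Function.Embedding.some) := by
    ext j
    cases j <;> simp
  rw [this, Finset.prod_insert (by simp), Finset.prod_map]
  rfl

/-- Lagrange interpolation at the nodes `b k + (b k)⁻¹` and `t + t⁻¹` evaluates the sum over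
the choice of the first coordinate. -/
lemma sum_first_coordinate {n : ℕ} (t : ℂ) (ht0 : t ≠ 0) (ht1 : t ^ 2 ≠ 1) (b : Fin n → ℂ)
    (h : GenericC t b) :
    ∑ p : Fin n, ∑ e : Bool,
        (singleC t (if e then (b p)⁻¹ else b p) *
          ∏ k ∈ Finset.univ.erase p, pairC t (if e then (b p)⁻¹ else b p) (b k)) =
      (1 - t ^ (2 * n)) * (1 + t ^ (2 * n + 1)) := by
  obtain ⟨hd, hc, h0⟩ := natDegree_stepPoly t b
  obtain ⟨P, hP, hPc, hPe⟩ := exists_antisymm_quotient n _ hd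
  set z : Fin n → ℂ := fun k => b k + (b k)⁻¹ with hzdef
  have hfac : ∀ k, 1 + t ^ 2 - t * z k ≠ 0 := by
    intro k
    have e : 1 + t ^ 2 - t * z k = (1 - t * b k) * (b k - t) / b k := by
      have := h.ne_zero k
      simp only [hzdef]
      field_simp
      ring
    rw [e]
    exact div_ne_zero (mul_ne_zero (sub_ne_zero.mpr (h.mul_ne_one k).symm)
      (sub_ne_zero.mpr (h.ne_t k))) (h.ne_zero k)
  have hzinj : Function.Injective z := by
    intro i j hij
    by_contra hne
    have e : z i - z j = (b j - b i) * (1 - b i * b j) / (b i * b j) := by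
      have := h.ne_zero i
      have := h.ne_zero j
      simp only [hzdef]
      field_simp
      ring
    rw [hij, sub_self, eq_comm, div_eq_zero_iff] at e
    rcases e with e | e
    · rcases mul_eq_zero.mp e with e | e
      · exact hne (h.inj (sub_eq_zero.mp e).symm)
      · exact h.pair i j (sub_eq_zero.mp e).symm
    · exact mul_ne_zero (h.ne_zero i) (h.ne_zero j) e
  have hz0 : ∀ k, (t + t⁻¹) - z k = (1 + t ^ 2 - t * z k) * t⁻¹ := by
    intro k
    field_simp
    ring
  let v : Option (Fin n) → ℂ := fun o => o.elim (t + t⁻¹) z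
  have hv : Function.Injective v := by
    have hne : ∀ k, z k ≠ t + t⁻¹ := fun k hk =>
      mul_ne_zero (hfac k) (inv_ne_zero ht0) (by rw [← hz0, hk, sub_self])
    rintro (_ | i) (_ | j) hij
    · rfl
    · exact absurd hij.symm (hne j)
    · exact absurd hij (hne i)
    · exact congrArg some (hzinj hij)
  have hL := Lagrange.coeff_eq_sum (s := Finset.univ) (v := v) hv.injOn (P := P)
    (by
      refine lt_of_le_of_lt Polynomial.degree_le_natDegree ?_
      rw [Finset.card_univ, Fintype.card_option, Fintype.card_fin]
      exact_mod_cast Nat.lt_succ_of_le hP)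
  rw [Finset.card_univ, Fintype.card_option, Fintype.card_fin, Nat.add_sub_cancel, hPc, h0, hc,
    Fintype.sum_option, prod_erase_option_none] at hL
  simp only [prod_erase_option_some] at hL
  have hstar : P.eval (t + t⁻¹) / ∏ k, ((t + t⁻¹) - z k) = -t * (1 - t) * t ^ (2 * n) := by
    have hN : ∏ k, (1 + t ^ 2 - t * z k) ≠ 0 := Finset.prod_ne_zero_iff.mpr fun k _ => hfac k
    have hPr : ∏ k, (1 + t ^ 4 * t⁻¹ ^ 2 - t ^ 2 * t⁻¹ * (b k + (b k)⁻¹)) =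
        ∏ k, (1 + t ^ 2 - t * z k) :=
      Finset.prod_congr rfl fun k _ => by simp only [hzdef]; field_simp
    rw [← hPe t ht0 ht1, eval_stepPoly, eval_stepPoly, hPr,
      Finset.prod_congr rfl fun k _ => hz0 k, Finset.prod_mul_distrib, Finset.prod_const,
      Finset.card_univ, Fintype.card_fin]
    have h1 : t ^ 2 - 1 ≠ 0 := sub_ne_zero.mpr ht1
    have e : 1 - t⁻¹ ^ 2 = (t ^ 2 - 1) / t ^ 2 := by field_simp
    rw [e, sub_self, inv_pow]
    field_simp
    ring
  have hterm : ∀ p, (∑ e : Bool, (singleC t (if e then (b p)⁻¹ else b p) *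
      ∏ k ∈ Finset.univ.erase p, pairC t (if e then (b p)⁻¹ else b p) (b k))) =
      -t⁻¹ * (P.eval (z p) / ((z p - (t + t⁻¹)) * ∏ k ∈ Finset.univ.erase p, (z p - z k))) := by
    intro p
    rw [Fintype.sum_bool, if_pos rfl, if_neg (by simp),
      single_mul_prod_pairC_eq t b h p _ (Or.inr rfl),
      single_mul_prod_pairC_eq t b h p _ (Or.inl rfl), ← add_div,
      add_comm, hPe (b p) (h.ne_zero p) (by rw [sq]; exact h.pair p p)]
    have e : z p - (t + t⁻¹) = -((1 + t ^ 2 - t * z p) * t⁻¹) := by rw [← hz0]; ring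
    rw [e]
    change P.eval (z p) / ((1 + t ^ 2 - t * z p) *
      ∏ k ∈ Finset.univ.erase p, (z p - z k)) = _
    have := hfac p
    generalize 1 + t ^ 2 - t * z p = A at *
    generalize ∏ k ∈ Finset.univ.erase p, (z p - z k) = B
    by_cases hB : B = 0
    · simp [hB]
    · field_simp
  rw [Finset.sum_congr rfl fun p _ => hterm p, ← Finset.mul_sum]
  have hL' : ∑ p, P.eval (z p) / ((z p - (t + t⁻¹)) * ∏ k ∈ Finset.univ.erase p, (z p - z k)) =
      -t - -t ^ 2 * t ^ (4 * n) - -t * (1 - t) * t ^ (2 * n) := by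
    rw [← hstar, hL]
    simp only [v, Option.elim]
    ring
  rw [hL']
  have e4 : t ^ (4 * n) = t ^ (2 * n) * t ^ (2 * n) := by rw [← pow_add]; congr 1; ring
  rw [e4, pow_succ]
  field_simp
  ring

/-- Macdonald-type evaluation of the type `C` sum. -/
lemma sum_termC {n : ℕ} (t : ℂ) (ht0 : t ≠ 0) (ht1 : t ^ 2 ≠ 1) (b : Fin n → ℂ)
    (h : GenericC t b) :
    ∑ w : SignedPerm n, termC t (sact w b) =
      ∏ k ∈ Finset.range n, ((1 - t ^ (2 * k + 2)) * (1 + t ^ (2 * k + 3))) := by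
  induction n with
  | zero => simp [termC]
  | succ n ih =>
    rw [sum_termC_succ, Finset.prod_range_succ, mul_comm]
    have hw : ∀ p : Fin (n + 1),
        ∑ w : SignedPerm n, termC t (sact w (b ∘ fun i => Equiv.swap 0 p i.succ)) =
          ∏ k ∈ Finset.range n, ((1 - t ^ (2 * k + 2)) * (1 + t ^ (2 * k + 3))) := fun p =>
      ih _ (h.comp ((Equiv.injective _).comp (Fin.succ_injective n)))
    simp only [hw, ← Finset.sum_mul]
    rw [sum_first_coordinate t ht0 ht1 b h]
    ring

lemma bB_snoc (m : ℕ) (t : ℂ) (b : Fin m → ℂ) :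
    bB m t (Fin.snoc (fun i => t * b i) t : Fin (m + 1) → ℂ) b =
      ((∏ i, (1 - t * (t * b i))) * (1 - t * t)) *
      ((∏ i, ((1 - t * (t * b i) * b i) * (1 - t * (t * b i) * (b i)⁻¹))) *
        ∏ i, ∏ j ∈ Finset.Ioi i,
          ((1 - t * (t * b i) * b j) * (1 - t * (t * b i) * (b j)⁻¹))) *
      ((∏ i, ∏ j ∈ Finset.Ioi i,
          ((1 - t * (t * b j) * b i) * (1 - t * (t * b j)⁻¹ * b i))) *
        ∏ j, ((1 - t * t * b j) * (1 - t * t⁻¹ * b j))) := by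
  have hIoi : ∀ i : Fin m, (Finset.univ.filter fun j => i < j) = Finset.Ioi i := fun i => by
    ext; simp
  unfold bB
  congr 1
  · congr 1
    · rw [Fin.prod_univ_castSucc]
      simp
    · rw [Finset.prod_filter, Fintype.prod_prod_type, ← Finset.prod_mul_distrib]
      refine Finset.prod_congr rfl fun i _ => ?_
      rw [← Finset.prod_filter]
      have : (Finset.univ.filter fun j => i ≤ j) = insert i (Finset.Ioi i) := by
        ext j
        simp [le_iff_eq_or_lt]
      rw [this, Finset.prod_insert (by simp)]
      simp
  · rw [Finset.prod_filter, Fintype.prod_prod_type, Fin.prod_univ_castSucc]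
    congr 1
    · rw [Finset.prod_comm]
      refine Finset.prod_congr rfl fun i _ => ?_
      rw [← hIoi, Finset.prod_filter]
      refine Finset.prod_congr rfl fun j _ => ?_
      simp
    · simp

lemma d1B_snoc (m : ℕ) (t : ℂ) (b : Fin m → ℂ) :
    d1B m (Fin.snoc (fun i => t * b i) t : Fin (m + 1) → ℂ) =
      ((∏ i, (1 - t * b i)) * (1 - t)) *
      ((∏ i, ∏ j ∈ Finset.Ioi i,
          ((1 - t * b i * (t * b j)) * (1 - t * b i * (t * b j)⁻¹))) *
        ∏ i, ((1 - t * b i * t) * (1 - t * b i * t⁻¹))) := by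
  have hIoi : ∀ i : Fin m, (Finset.univ.filter fun j => i < j) = Finset.Ioi i := fun i => by
    ext; simp
  unfold d1B
  congr 1
  · rw [Fin.prod_univ_castSucc]
    simp
  · rw [Finset.prod_filter, Fintype.prod_prod_type, Fin.prod_univ_castSucc,
      ← Finset.prod_mul_distrib]
    have h : ∀ y : Fin (m + 1), ¬ Fin.last m < y := fun y => not_lt.mpr (Fin.le_last y)
    simp only [h, if_false, Finset.prod_const_one, mul_one]
    refine Finset.prod_congr rfl fun i _ => ?_
    rw [Fin.prod_univ_castSucc, ← hIoi, Finset.prod_filter]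
    simp [Fin.castSucc_lt_last]

lemma d0B_eq (m : ℕ) (b : Fin m → ℂ) :
    d0B m b = (∏ i, (1 - b i ^ 2)) *
      ∏ i, ∏ j ∈ Finset.Ioi i, ((1 - b i * b j) * (1 - b i * (b j)⁻¹)) := by
  unfold d0B
  rw [prod_filter_lt_eq fun i j => (1 - b i * b j) * (1 - b i * (b j)⁻¹)]

lemma GenericC.one_sub_mul_inv_ne_zero {m : ℕ} {t : ℂ} {b : Fin m → ℂ} (h : GenericC t b)
    {i j : Fin m} (hij : i ≠ j) : 1 - b i * (b j)⁻¹ ≠ 0 := by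
  intro h0
  have := h.ne_zero j
  field_simp at h0
  exact hij (h.inj (by linear_combination -h0))

lemma cB_snoc (m : ℕ) (t : ℂ) (ht0 : t ≠ 0) (b : Fin m → ℂ) (h : GenericC t b)
    (hreg : BRegular (m + 1) (Fin.snoc (fun i => t * b i) t : Fin (m + 1) → ℂ)) :
    cB m t (Fin.snoc (fun i => t * b i) t : Fin (m + 1) → ℂ) b = (1 + t) * termC t b := by
  have hsq : ∀ i, 1 - b i ^ 2 ≠ 0 := fun i h0 => h.pair i i (by linear_combination -h0)
  have hd0 : d0B m b ≠ 0 := by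
    rw [d0B_eq]
    refine mul_ne_zero (Finset.prod_ne_zero_iff.mpr fun i _ => hsq i)
      (Finset.prod_ne_zero_iff.mpr fun i _ => Finset.prod_ne_zero_iff.mpr fun j hj => ?_)
    exact mul_ne_zero (sub_ne_zero.mpr (h.pair i j).symm)
      (h.one_sub_mul_inv_ne_zero (Finset.mem_Ioi.mp hj).ne)
  have hd1 : d1B m (Fin.snoc (fun i => t * b i) t : Fin (m + 1) → ℂ) ≠ 0 := by
    have h0 : ∀ i, (Fin.snoc (fun i => t * b i) t : Fin (m + 1) → ℂ) i ≠ 0 := by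
      intro i
      refine Fin.lastCases ?_ (fun i => ?_) i
      · simpa using ht0
      · simpa using ⟨ht0, h.ne_zero i⟩
    rw [d1B_eq m _ h0]
    exact mul_ne_zero (Finset.prod_ne_zero_iff.mpr fun i _ => mul_ne_zero
      (sub_ne_zero.mpr (hreg.1 i).symm) (pow_ne_zero _ (neg_ne_zero.mpr (h0 i))))
      (symVandermonde_ne_zero h0 hreg.2.1 hreg.2.2)
  unfold cB
  rw [div_eq_iff (mul_ne_zero hd1 hd0), bB_snoc, d1B_snoc, d0B_eq, termC]
  have hpairs : (∏ i, ∏ j ∈ Finset.Ioi i,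
        ((1 - t * (t * b i) * b j) * (1 - t * (t * b i) * (b j)⁻¹))) *
      (∏ i, ∏ j ∈ Finset.Ioi i, ((1 - t * (t * b j) * b i) * (1 - t * (t * b j)⁻¹ * b i))) =
      (∏ i, ∏ j ∈ Finset.Ioi i, pairC t (b i) (b j)) *
      (∏ i, ∏ j ∈ Finset.Ioi i, ((1 - t * b i * (t * b j)) * (1 - t * b i * (t * b j)⁻¹))) *
      ∏ i, ∏ j ∈ Finset.Ioi i, ((1 - b i * b j) * (1 - b i * (b j)⁻¹)) := by
    simp only [← Finset.prod_mul_distrib]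
    refine Finset.prod_congr rfl fun i _ => Finset.prod_congr rfl fun j hj => ?_
    have h1 : 1 - b i * b j ≠ 0 := sub_ne_zero.mpr (h.pair i j).symm
    have h2 := h.one_sub_mul_inv_ne_zero (Finset.mem_Ioi.mp hj).ne
    have e1 : t * b i * (t * b j)⁻¹ = b i * (b j)⁻¹ := by field_simp
    have e2 : t * (t * b j)⁻¹ * b i = b i * (b j)⁻¹ := by field_simp
    rw [e1, e2]
    unfold pairC
    generalize (b j)⁻¹ = c at *
    field_simp
  have hsingles : (∏ i, (1 - t * (t * b i))) *
      (∏ i, ((1 - t * (t * b i) * b i) * (1 - t * (t * b i) * (b i)⁻¹))) *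
      (∏ j, ((1 - t * t * b j) * (1 - t * t⁻¹ * b j))) =
      (∏ i, singleC t (b i)) * (∏ i, (1 - t * b i)) *
      (∏ i, ((1 - t * b i * t) * (1 - t * b i * t⁻¹))) * ∏ i, (1 - b i ^ 2) := by
    simp only [← Finset.prod_mul_distrib]
    refine Finset.prod_congr rfl fun i _ => ?_
    have h1 := hsq i
    have h2 := h.ne_zero i
    have e1 : t * b i * t⁻¹ = b i := by field_simp
    have e2 : t * t⁻¹ * b i = b i := by field_simp
    have e3 : t * (t * b i) * (b i)⁻¹ = t * t := by field_simp
    rw [e1, e2, e3]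
    unfold singleC
    field_simp
    ring
  have hswap : ∀ A u B C D E A' B' C' D' E' F' : ℂ, A * B * E = A' * B' * C' * D' →
      C * D = E' * F' * u → A * (1 - t * t) * (B * C) * (D * E) =
        (1 + t) * (A' * E') * (B' * (1 - t) * (F' * C') * (D' * u)) := by
    intro A u B C D E A' B' C' D' E' F' h1 h2
    linear_combination (1 - t * t) * (C * D) * h1 + (1 - t * t) * (A' * B' * C' * D') * h2
  exact hswap _ _ _ _ _ _ _ _ _ _ _ _ hsingles hpairs

/-- Summing over the first group only, for `b` generic. -/
lemma sum_cB_eq_termC (m : ℕ) (t : ℂ) (ht0 : t ≠ 0) (ht1 : t ^ 2 ≠ 1) (a : Fin (m + 1) → ℂ)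
    (ha0 : ∀ i, a i ≠ 0) (ha : BRegular (m + 1) a) (b : Fin m → ℂ) (h : GenericC t b)
    (h1 : ∀ i, t ^ 2 * b i ≠ 1) (h2 : ∀ i j, t ^ 2 * (b i * b j) ≠ 1) :
    ∑ w : SignedPerm (m + 1), cB m t (sact w a) b = (1 + t) * termC t b := by
  have hb1 : ∀ i, b i ≠ 1 := fun i hi => h.pair i i (by rw [hi, one_mul])
  have hreg : BRegular (m + 1) (Fin.snoc (fun i => t * b i) t : Fin (m + 1) → ℂ) := by
    refine ⟨fun i => ?_, fun i j => ?_, fun i j => ?_⟩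
    · refine Fin.lastCases ?_ (fun i => ?_) i
      · simpa using fun ht => ht1 (by rw [ht, one_pow])
      · simpa using h.mul_ne_one i
    · refine Fin.lastCases ?_ (fun i => ?_) i
      · exact fun hj => absurd (Fin.le_last j) (not_le.mpr hj)
      · refine Fin.lastCases ?_ (fun j => ?_) j
        · intro _ he
          simp only [Fin.snoc_castSucc, Fin.snoc_last] at he
          exact h1 i (by linear_combination he)
        · intro _ he
          simp only [Fin.snoc_castSucc] at he
          exact h2 i j (by linear_combination he)
    · refine Fin.lastCases ?_ (fun i => ?_) i
      · refine Fin.lastCases ?_ (fun j => ?_) j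
        · exact fun hne => absurd rfl hne
        · intro _ he
          simp only [Fin.snoc_castSucc, Fin.snoc_last] at he
          exact hb1 j (mul_left_cancel₀ ht0 (by rw [← he, mul_one]))
      · refine Fin.lastCases ?_ (fun j => ?_) j
        · intro _ he
          simp only [Fin.snoc_castSucc, Fin.snoc_last] at he
          exact hb1 i (mul_left_cancel₀ ht0 (by rw [he, mul_one]))
        · intro hne he
          simp only [Fin.snoc_castSucc] at he
          exact hne (congrArg _ (h.inj (mul_left_cancel₀ ht0 he)))
  rw [sum_cB_eq_snoc m t a b ha0 ha h.ne_zero ht0 hreg, cB_snoc m t ht0 b h hreg]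

lemma CRegular.mul_ne_one {m : ℕ} {b : Fin m → ℂ} (hb : CRegular m b) (i j : Fin m) :
    b i * b j ≠ 1 := by
  rcases le_total i j with h | h
  · exact hb.1 i j h
  · rw [mul_comm]
    exact hb.1 j i h

lemma CRegular.sact_mul_ne_one {m : ℕ} {b : Fin m → ℂ} (hb : CRegular m b)
    (hb0 : ∀ i, b i ≠ 0) (w : SignedPerm m) (i j : Fin m) : sact w b i * sact w b j ≠ 1 := by
  have hne : ∀ k l, w.1 k ≠ w.1 l → b (w.2⁻¹ k) ≠ b (w.2⁻¹ l) := fun k l hkl =>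
    hb.2 _ _ fun h => hkl (congrArg w.1 (w.2⁻¹.injective h))
  have h1 := hb.mul_ne_one (w.2⁻¹ i) (w.2⁻¹ j)
  have hi := hb0 (w.2⁻¹ i)
  have hj := hb0 (w.2⁻¹ j)
  unfold sact
  split_ifs with hwi hwj hwj <;> intro he
  · rw [← mul_inv, inv_eq_one] at he
    exact h1 he
  · field_simp at he
    exact hne i j (by rw [hwi]; exact fun h => hwj h.symm) he.symm
  · field_simp at he
    exact hne i j (by rw [hwj]; exact hwi) he
  · exact h1 he

lemma CRegular.sact_injective {m : ℕ} {b : Fin m → ℂ} (hb : CRegular m b)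
    (hb0 : ∀ i, b i ≠ 0) (w : SignedPerm m) : Function.Injective (sact w b) := by
  intro i j hij
  by_contra hne
  have h1 := hb.mul_ne_one (w.2⁻¹ i) (w.2⁻¹ j)
  have h2 := hb.2 (w.2⁻¹ i) (w.2⁻¹ j) fun h => hne (w.2⁻¹.injective h)
  have hi := hb0 (w.2⁻¹ i)
  have hj := hb0 (w.2⁻¹ j)
  unfold sact at hij
  split_ifs at hij
  · exact h2 (inv_injective hij)
  · exact h1 (by rw [← hij, mul_inv_cancel₀ hi])
  · exact h1 (by rw [hij, inv_mul_cancel₀ hj])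
  · exact h2 hij

open Filter Polynomial in
lemma eventually_sq_mul_ne_one (c : ℂ) : ∀ᶠ t : ℂ in cofinite, t ^ 2 * c ≠ 1 := by
  have hne : (C c * X ^ 2 - 1 : ℂ[X]) ≠ 0 := fun h => by
    simpa using congrArg (eval 0) h
  refine (Polynomial.finite_setOfPred_isRoot hne).subset fun t ht => ?_
  have ht : t ^ 2 * c = 1 := not_not.mp ht
  simp only [Set.mem_ofPred_eq, IsRoot.def, eval_sub, eval_mul, eval_C, eval_pow, eval_X, eval_one]
  linear_combination ht

open Filter in
lemma eventually_generic {m : ℕ} (b : Fin m → ℂ) (hb0 : ∀ i, b i ≠ 0) (hb : CRegular m b) :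
    ∀ᶠ t : ℂ in cofinite, t ≠ 0 ∧ t ^ 2 ≠ 1 ∧ ∀ w : SignedPerm m, GenericC t (sact w b) ∧
      (∀ i, t ^ 2 * sact w b i ≠ 1) ∧ ∀ i j, t ^ 2 * (sact w b i * sact w b j) ≠ 1 := by
  have hne : ∀ c : ℂ, ∀ᶠ t : ℂ in cofinite, t ≠ c := fun c =>
    (Set.finite_singleton c).compl_mem_cofinite
  have hsq := eventually_sq_mul_ne_one
  refine (hne 0).and (((hsq 1).mono fun t ht => by simpa using ht).and
    (eventually_all.mpr fun w => ?_))
  have h0 := sact_ne_zero w b hb0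
  filter_upwards [eventually_all.mpr fun i => hne (sact w b i)⁻¹,
    eventually_all.mpr fun i => hne (-(sact w b i)⁻¹), eventually_all.mpr fun i => hne (sact w b i),
    eventually_all.mpr fun i => hne (-(sact w b i)), eventually_all.mpr fun i => hsq (sact w b i),
    eventually_all.mpr fun i => eventually_all.mpr fun j => hsq (sact w b i * sact w b j)]
    with t h1 h2 h3 h4 h5 h6
  refine ⟨⟨h0, fun i hi => h1 i (eq_inv_of_mul_eq_one_left hi), fun i hi => h2 i ?_,
    fun i hi => h3 i hi.symm, fun i hi => h4 i (by rw [hi, neg_neg]),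
    hb.sact_mul_ne_one hb0 w, hb.sact_injective hb0 w⟩, h5, h6⟩
  rw [← neg_eq_iff_eq_neg]
  exact eq_inv_of_mul_eq_one_left (by rw [neg_mul, hi, neg_neg])

lemma continuous_AB (m : ℕ) (a : Fin (m + 1) → ℂ) (b : Fin m → ℂ) :
    Continuous fun t => AB m t a b := by
  unfold AB cB bB
  fun_prop

/-- The evaluation of `AB` for every complex parameter `t`. -/
lemma AB_eq (m : ℕ) (a : Fin (m + 1) → ℂ) (b : Fin m → ℂ)
    (ha0 : ∀ i, a i ≠ 0) (hb0 : ∀ i, b i ≠ 0)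
    (ha : BRegular (m + 1) a) (hb : CRegular m b) (t : ℂ) :
    AB m t a b = (1 + t ^ (2 * m + 1)) *
      ∏ k ∈ Finset.range m, ((1 + t ^ (2 * k + 1)) * (1 - t ^ (2 * k + 2))) := by
  have hgen := eventually_generic b hb0 hb
  have hdense := (Filter.mem_cofinite.mp hgen).countable.dense_compl ℂ
  rw [compl_compl] at hdense
  refine congrFun (Continuous.ext_on hdense (continuous_AB m a b)
    (g := fun t => (1 + t ^ (2 * m + 1)) *
      ∏ k ∈ Finset.range m, ((1 + t ^ (2 * k + 1)) * (1 - t ^ (2 * k + 2)))) (by fun_prop) ?_) t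
  rintro t ⟨ht0, ht1, hw⟩
  dsimp only
  have hid : sact ((fun _ => false, 1) : SignedPerm m) b = b := by
    funext k
    simp [sact]
  unfold AB
  rw [Finset.sum_comm, Finset.sum_congr rfl fun w _ =>
    sum_cB_eq_termC m t ht0 ht1 a ha0 ha _ (hw w).1 (hw w).2.1 (hw w).2.2, ← Finset.mul_sum,
    sum_termC t ht0 ht1 b (hid ▸ (hw _).1), Finset.prod_mul_distrib, Finset.prod_mul_distrib]
  have hodd := (Finset.prod_range_succ (fun k => 1 + t ^ (2 * k + 1)) m).symm.trans
    (Finset.prod_range_succ' (fun k => 1 + t ^ (2 * k + 1)) m)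
  simp only [mul_zero, zero_add, pow_one, mul_add, mul_one, add_assoc, Nat.reduceAdd] at hodd
  linear_combination (-∏ k ∈ Finset.range m, (1 - t ^ (2 * k + 2))) * hodd

/-- Case B of the paper's Proposition: for any regular pair, the Weyl-group sum equals
`(1 + t^{2m+1}) ∏_{k=1}^{m} (1 + t^{2k-1})(1 - t^{2k})`, i.e.
`(L(1,χ)ζ(2)⋯ζ(2m)L(2m+1,χ))⁻¹` with respect to `q_F = t⁻¹`. -/
theorem stmt7 (m : ℕ) (hm : 1 ≤ m) (q : ℝ) (hq : 1 < q) (t : ℂ)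
    (ht : t = ((Real.sqrt q)⁻¹ : ℝ))
    (a : Fin (m + 1) → ℂ) (b : Fin m → ℂ)
    (ha0 : ∀ i, a i ≠ 0) (hb0 : ∀ i, b i ≠ 0)
    (ha : BRegular (m + 1) a) (hb : CRegular m b) :
    AB m t a b =
      (1 + t ^ (2 * m + 1)) *
        ∏ k ∈ Finset.range m, ((1 + t ^ (2 * k + 1)) * (1 - t ^ (2 * k + 2))) := by
  exact AB_eq m a b ha0 hb0 ha hb t

end GrossPrasadCaseB
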